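/- Let d ≥ 1, T > 0, C₀ > 0, C > 0, let a_j, ã_j : [0,T] → ℝ be continuous with a_j(t) ≥ 0, and let V₁, V₂ : [0,T]×ℝ^d → ℝ be continuous, smooth in x with all x-derivatives continuous on [0,T]×ℝ^d, satisfying V₁(t,x) ≥ −C₀, |∂^β_x V₁(t,x)| ≤ C^{|β|+1}β! for |β| ≥ 2, and |∂^β_x V₂(t,x)| ≤ C^{|β|+1}β! for |β| ≥ 1, for all (t,x). Suppose u : [0,T] → 𝒮(ℝ^d) is continuously differentiable (in the topology of 𝒮(ℝ^d)) and satisfies u'(t) − Σ_j a_j(t)∂²u(t)/∂x_j² + Σ_j ã_j(t)∂u(t)/∂x_j + V₁(t,·)u(t) + iV₂(t,·)u(t) = 0 for all t ∈ [0,T], and that there exists A > 0 with ‖∂^α u(0)‖_{L²} ≤ A^{|α|+1}α! for every multi-index α. Then there exists A' > 0 such that ‖∂^α u(t)‖_{L²} ≤ A'^{|α|+1}α! for every t ∈ [0,T] and every multi-index α. -/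

import Mathlib

open MeasureTheory Complex Filter
open scoped BigOperators RealInnerProductSpace

noncomputable section

/-- Euclidean space `ℝ^d`. -/
abbrev Ed (d : ℕ) : Type := EuclideanSpace ℝ (Fin d)

/-- Partial derivative in the `j`-th coordinate direction. -/
def pd {F : Type*} [NormedAddCommGroup F] [NormedSpace ℝ F]
    (d : ℕ) (j : Fin d) (f : Ed d → F) : Ed d → F :=
  fun x => fderiv ℝ f x (EuclideanSpace.single j 1)

/-- Iterated partial derivative `∂^α` for a multi-index `α : Fin d → ℕ`. -/
def md {F : Type*} [NormedAddCommGroup F] [NormedSpace ℝ F]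
    {d : ℕ} (α : Fin d → ℕ) (f : Ed d → F) : Ed d → F :=
  (List.finRange d).foldr (fun j g => (pd d j)^[α j] g) f

/-- Length `|α| = α₁ + ⋯ + α_d` of a multi-index. -/
def mlen {d : ℕ} (α : Fin d → ℕ) : ℕ := ∑ j, α j

/-- `L²` inner product `⟨f, g⟩ = ∫ f(x) conj(g(x)) dx` (antilinear in the second factor). -/
def ip {d : ℕ} (f g : Ed d → ℂ) : ℂ := ∫ x, f x * (starRingEnd ℂ) (g x)

/-- Square `‖f‖²` of the `L²` norm. -/
def l2sq {d : ℕ} (f : Ed d → ℂ) : ℝ := ∫ x, ‖f x‖ ^ 2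

/-- The factorial `α! = α₁!⋯α_d!` of a multi-index. -/
def mfact {d : ℕ} (α : Fin d → ℕ) : ℕ := ∏ j, Nat.factorial (α j)

/-- The `L²` norm. -/
def l2norm {d : ℕ} (f : Ed d → ℂ) : ℝ := Real.sqrt (∫ x, ‖f x‖ ^ 2)

/-- Time dependent operator `ℒ(t)u = -Σ a_j(t) ∂²u/∂x_j² + Σ aa_j(t) ∂u/∂x_j
    + V₁(t,·) u + i V₂(t,·) u`. -/
def LopT {d : ℕ} (a aa : Fin d → ℝ → ℝ) (V₁ V₂ : ℝ → Ed d → ℝ)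
    (t : ℝ) (u : Ed d → ℂ) : Ed d → ℂ :=
  fun x => -∑ j, (a j t : ℂ) * pd d j (pd d j u) x + ∑ j, (aa j t : ℂ) * pd d j u x
    + (V₁ t x : ℂ) * u x + Complex.I * (V₂ t x : ℂ) * u x

section SmoothCalculus

variable {F G : Type*} [NormedAddCommGroup F] [NormedSpace ℝ F]
  [NormedAddCommGroup G] [NormedSpace ℝ G] {d : ℕ}

lemma contDiff_pd (j : Fin d) {f : Ed d → F} (hf : ContDiff ℝ (⊤ : ℕ∞) f) :
    ContDiff ℝ (⊤ : ℕ∞) (pd d j f) :=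
  (hf.fderiv_right (m := (⊤ : ℕ∞)) (by simp)).clm_apply contDiff_const

lemma pd_comm (i j : Fin d) {f : Ed d → F} (hf : ContDiff ℝ (⊤ : ℕ∞) f) :
    pd d i (pd d j f) = pd d j (pd d i f) := by
  have hdiff : Differentiable ℝ (fderiv ℝ f) :=
    (hf.fderiv_right (m := (⊤ : ℕ∞)) (by simp)).differentiable (by simp)
  have key (k l : Fin d) (x : Ed d) : pd d k (pd d l f) x =
      fderiv ℝ (fderiv ℝ f) x (EuclideanSpace.single k 1) (EuclideanSpace.single l 1) := by
    unfold pd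
    rw [fderiv_clm_apply (hdiff x) (differentiableAt_const _)]
    simp
  funext x
  rw [key, key]
  have hs : IsSymmSndFDerivAt ℝ f x :=
    (hf.contDiffAt (x := x)).isSymmSndFDerivAt (by
      rw [minSmoothness_of_isRCLikeNormedField]
      exact WithTop.coe_le_coe.2 le_top)
  exact hs _ _

lemma pd_add (j : Fin d) {f g : Ed d → F} (hf : ContDiff ℝ (⊤ : ℕ∞) f)
    (hg : ContDiff ℝ (⊤ : ℕ∞) g) : pd d j (f + g) = pd d j f + pd d j g := by
  funext x
  simp [pd, fderiv_add (hf.differentiable (by simp) x) (hg.differentiable (by simp) x)]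

lemma pd_smul (j : Fin d) {f : Ed d → ℝ} {g : Ed d → F} (hf : ContDiff ℝ (⊤ : ℕ∞) f)
    (hg : ContDiff ℝ (⊤ : ℕ∞) g) : pd d j (f • g) = f • pd d j g + pd d j f • g := by
  funext x
  have := fderiv_smul (hf.differentiable (by simp) x) (hg.differentiable (by simp) x)
  simp [pd, this]

lemma pd_clm_comp (L : F →L[ℝ] G) (j : Fin d) {f : Ed d → F}
    (hf : ContDiff ℝ (⊤ : ℕ∞) f) : pd d j (L ∘ f) = L ∘ pd d j f := by
  funext x
  simp only [pd, Function.comp_apply]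
  rw [fderiv_comp x L.differentiableAt (hf.differentiable (by simp) x)]
  simp

lemma contDiff_iterate_pd (j : Fin d) (n : ℕ) {f : Ed d → F} (hf : ContDiff ℝ (⊤ : ℕ∞) f) :
    ContDiff ℝ (⊤ : ℕ∞) ((pd d j)^[n] f) := by
  induction n with
  | zero => exact hf
  | succ n ih => rw [Function.iterate_succ_apply']; exact contDiff_pd j ih

lemma iterate_pd_pd (i j : Fin d) (n : ℕ) {f : Ed d → F} (hf : ContDiff ℝ (⊤ : ℕ∞) f) :
    (pd d i)^[n] (pd d j f) = pd d j ((pd d i)^[n] f) := by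
  induction n with
  | zero => rfl
  | succ n ih =>
    rw [Function.iterate_succ_apply', Function.iterate_succ_apply', ih,
      pd_comm i j (contDiff_iterate_pd i n hf)]

lemma contDiff_foldr_pd (l : List (Fin d)) (α : Fin d → ℕ) {f : Ed d → F}
    (hf : ContDiff ℝ (⊤ : ℕ∞) f) :
    ContDiff ℝ (⊤ : ℕ∞) (l.foldr (fun j g => (pd d j)^[α j] g) f) := by
  induction l with
  | nil => exact hf
  | cons i l ih => exact contDiff_iterate_pd i _ ih

lemma foldr_pd_pd (l : List (Fin d)) (α : Fin d → ℕ) (j : Fin d) {f : Ed d → F}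
    (hf : ContDiff ℝ (⊤ : ℕ∞) f) :
    l.foldr (fun j g => (pd d j)^[α j] g) (pd d j f) =
      pd d j (l.foldr (fun j g => (pd d j)^[α j] g) f) := by
  induction l with
  | nil => rfl
  | cons i l ih =>
    simp only [List.foldr_cons]
    rw [ih, iterate_pd_pd i j _ (contDiff_foldr_pd l α hf)]

lemma foldr_pd_add_single_of_notMem (l : List (Fin d)) (α : Fin d → ℕ) {j : Fin d} (hj : j ∉ l)
    (f : Ed d → F) :
    l.foldr (fun k g => (pd d k)^[(α + Pi.single j 1 : Fin d → ℕ) k] g) f =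
      l.foldr (fun k g => (pd d k)^[α k] g) f := by
  induction l with
  | nil => rfl
  | cons i l ih =>
    rw [List.mem_cons, not_or] at hj
    simp only [List.foldr_cons]
    rw [ih hj.2]
    simp [Pi.single_eq_of_ne (Ne.symm hj.1)]

lemma foldr_pd_add_single (l : List (Fin d)) (hl : l.Nodup) (α : Fin d → ℕ) {j : Fin d}
    (hj : j ∈ l) {f : Ed d → F} (hf : ContDiff ℝ (⊤ : ℕ∞) f) :
    l.foldr (fun k g => (pd d k)^[(α + Pi.single j 1 : Fin d → ℕ) k] g) f =
      pd d j (l.foldr (fun k g => (pd d k)^[α k] g) f) := by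
  induction l with
  | nil => simp at hj
  | cons i l ih =>
    rw [List.nodup_cons] at hl
    simp only [List.foldr_cons]
    by_cases h : j = i
    · subst h
      rw [foldr_pd_add_single_of_notMem l α hl.1]
      simp [Function.iterate_succ_apply']
    · have hjl : j ∈ l := (List.mem_cons.1 hj).resolve_left h
      rw [ih hl.2 hjl, ← iterate_pd_pd i j _ (contDiff_foldr_pd l α hf)]
      simp [Pi.single_eq_of_ne (Ne.symm h)]

lemma contDiff_md (α : Fin d → ℕ) {f : Ed d → F} (hf : ContDiff ℝ (⊤ : ℕ∞) f) :
    ContDiff ℝ (⊤ : ℕ∞) (md α f) :=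
  contDiff_foldr_pd _ α hf

lemma md_pd (α : Fin d → ℕ) (j : Fin d) {f : Ed d → F} (hf : ContDiff ℝ (⊤ : ℕ∞) f) :
    md α (pd d j f) = pd d j (md α f) :=
  foldr_pd_pd _ α j hf

lemma md_add_single (α : Fin d → ℕ) (j : Fin d) {f : Ed d → F} (hf : ContDiff ℝ (⊤ : ℕ∞) f) :
    md (α + Pi.single j 1) f = md α (pd d j f) := by
  rw [md_pd α j hf]
  exact foldr_pd_add_single _ (List.nodup_finRange d) α (List.mem_finRange j) hf

lemma md_zero (f : Ed d → F) : md (0 : Fin d → ℕ) f = f := by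
  unfold md
  induction List.finRange d with
  | nil => rfl
  | cons i l ih => exact ih

lemma mlen_add_single (α : Fin d → ℕ) (j : Fin d) : mlen (α + Pi.single j 1) = mlen α + 1 := by
  simp [mlen, Finset.sum_add_distrib]

lemma mfact_add_single (α : Fin d → ℕ) (j : Fin d) :
    mfact (α + Pi.single j 1) = (α j + 1) * mfact α := by
  unfold mfact
  rw [← Finset.mul_prod_erase _ _ (Finset.mem_univ j),
    ← Finset.mul_prod_erase Finset.univ (fun k => (α k).factorial) (Finset.mem_univ j)]
  have : ∏ k ∈ Finset.univ.erase j, ((α + Pi.single j 1 : Fin d → ℕ) k).factorial =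
      ∏ k ∈ Finset.univ.erase j, (α k).factorial :=
    Finset.prod_congr rfl fun k hk => by
      simp [Pi.single_eq_of_ne (Finset.ne_of_mem_erase hk)]
  rw [this]
  simp [Nat.factorial_succ, mul_assoc]

/-- Induction on multi-indices, one unit vector at a time. -/
lemma multiIndex_induction {P : (Fin d → ℕ) → Prop} (zero : P 0)
    (step : ∀ α j, P α → P (α + Pi.single j 1)) (α : Fin d → ℕ) : P α := by
  induction h : mlen α generalizing α with
  | zero =>
    have : α = 0 := by
      funext k
      simpa using (Finset.sum_eq_zero_iff.1 h) k (Finset.mem_univ k)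
    exact this ▸ zero
  | succ n ih =>
    obtain ⟨j, hj⟩ : ∃ j, α j ≠ 0 := by
      by_contra! hc
      simp [mlen, hc] at h
    have hα : α - Pi.single j 1 + Pi.single j 1 = α := by
      funext k
      by_cases hk : k = j
      · subst hk; simp; omega
      · simp [Pi.single_eq_of_ne hk]
    rw [← hα]
    refine step _ _ (ih _ ?_)
    have := mlen_add_single (α - Pi.single j 1) j
    rw [hα] at this
    omega

lemma md_clm_comp (L : F →L[ℝ] G) (α : Fin d → ℕ) {f : Ed d → F}
    (hf : ContDiff ℝ (⊤ : ℕ∞) f) : md α (L ∘ f) = L ∘ md α f := by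
  induction α using multiIndex_induction generalizing f with
  | zero => simp [md_zero]
  | step α j ih =>
    rw [md_add_single α j hf, md_add_single α j (L.contDiff.comp hf), pd_clm_comp L j hf,
      ih (contDiff_pd j hf)]

lemma md_add (α : Fin d → ℕ) {f g : Ed d → F} (hf : ContDiff ℝ (⊤ : ℕ∞) f)
    (hg : ContDiff ℝ (⊤ : ℕ∞) g) : md α (f + g) = md α f + md α g := by
  induction α using multiIndex_induction generalizing f g with
  | zero => simp [md_zero]
  | step α j ih =>
    rw [md_add_single α j hf, md_add_single α j hg, md_add_single α j (f := f + g) (hf.add hg), pd_add j hf hg,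
      ih (contDiff_pd j hf) (contDiff_pd j hg)]

/-- The normalised derivative `∂^α f / α!`. -/
def nd (α : Fin d → ℕ) (f : Ed d → F) : Ed d → F :=
  fun x => (mfact α : ℝ)⁻¹ • md α f x

lemma mfact_pos (α : Fin d → ℕ) : 0 < mfact α :=
  Finset.prod_pos fun _ _ => Nat.factorial_pos _

lemma nd_zero (f : Ed d → F) : nd (0 : Fin d → ℕ) f = f := by
  funext x
  simp [nd, md_zero, mfact]

lemma nd_add (α : Fin d → ℕ) {f g : Ed d → F} (hf : ContDiff ℝ (⊤ : ℕ∞) f)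
    (hg : ContDiff ℝ (⊤ : ℕ∞) g) (x : Ed d) : nd α (f + g) x = nd α f x + nd α g x := by
  simp [nd, md_add α hf hg]

lemma nd_add_single (α : Fin d → ℕ) (j : Fin d) {f : Ed d → F} (hf : ContDiff ℝ (⊤ : ℕ∞) f)
    (x : Ed d) : ((α j : ℝ) + 1) • nd (α + Pi.single j 1) f x = nd α (pd d j f) x := by
  have h : ((α j : ℝ) + 1) ≠ 0 := by positivity
  simp only [nd, md_add_single α j hf, mfact_add_single, smul_smul]
  push_cast
  rw [mul_inv, mul_inv_cancel_left₀ h]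

lemma sum_Iic_add_single_coord_smul (α : Fin d → ℕ) (j : Fin d) (H : (Fin d → ℕ) → F) :
    ∑ β ∈ Finset.Iic (α + Pi.single j 1), (β j : ℝ) • H β =
      ∑ β ∈ Finset.Iic α, ((β j : ℝ) + 1) • H (β + Pi.single j 1) := by
  symm
  refine Finset.sum_of_injOn (fun β => β + Pi.single j 1) (fun _ _ _ _ h => add_right_cancel h)
    ?_ ?_ ?_
  · intro β hβ
    simp only [Finset.coe_Iic, Set.mem_Iic] at hβ ⊢
    exact add_le_add_left hβ _
  · intro β hβ hβ'
    have : β j = 0 := by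
      by_contra hne
      apply hβ'
      have hs : β - Pi.single j 1 + Pi.single j 1 = β := by
        funext k
        by_cases hk : k = j
        · subst hk; simp; omega
        · simp [Pi.single_eq_of_ne hk]
      refine ⟨β - Pi.single j 1, ?_, hs⟩
      simp only [Finset.coe_Iic, Set.mem_Iic]
      rw [Finset.mem_Iic, ← hs] at hβ
      exact le_of_add_le_add_right hβ
    simp [this]
  · intro β _
    simp

lemma sum_Iic_add_single_sub_coord_smul (α : Fin d → ℕ) (j : Fin d) (H : (Fin d → ℕ) → F) :
    ∑ β ∈ Finset.Iic (α + Pi.single j 1), ((α j : ℝ) + 1 - β j) • H β =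
      ∑ β ∈ Finset.Iic α, (((α - β) j : ℕ) + 1 : ℝ) • H β := by
  symm
  have hsub : Finset.Iic α ⊆ Finset.Iic (α + Pi.single j 1) :=
    Finset.Iic_subset_Iic.2 le_self_add
  rw [← Finset.sum_subset hsub (f := fun β => ((α j : ℝ) + 1 - β j) • H β)]
  · refine Finset.sum_congr rfl fun β hβ => ?_
    rw [Finset.mem_Iic] at hβ
    congr 1
    rw [Pi.sub_apply, Nat.cast_sub (hβ j)]
    ring
  · intro β hβ hβ'
    rw [Finset.mem_Iic] at hβ hβ'
    have : β j = α j + 1 := by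
      by_contra hne
      apply hβ'
      intro k
      change β k ≤ α k
      have hk : β k ≤ α k + (Pi.single j 1 : Fin d → ℕ) k := hβ k
      by_cases hkj : k = j
      · subst hkj
        rw [Pi.single_eq_same] at hk
        omega
      · simpa [Pi.single_eq_of_ne hkj] using hk
    simp [this]

/-- The Leibniz rule for normalised derivatives. -/
lemma nd_smul (α : Fin d → ℕ) {f : Ed d → ℝ} {g : Ed d → F} (hf : ContDiff ℝ (⊤ : ℕ∞) f)
    (hg : ContDiff ℝ (⊤ : ℕ∞) g) (x : Ed d) :
    nd α (f • g) x = ∑ β ∈ Finset.Iic α, nd β f x • nd (α - β) g x := by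
  induction α using multiIndex_induction generalizing f g with
  | zero =>
    have : Finset.Iic (0 : Fin d → ℕ) = {0} := by ext β; simp
    simp [this, nd_zero]
  | step α j ih =>
    have h : ((α j : ℝ) + 1) ≠ 0 := by positivity
    have hfg : ContDiff ℝ (⊤ : ℕ∞) (f • g) := hf.smul hg
    refine smul_right_injective F h ?_
    change ((α j : ℝ) + 1) • _ = ((α j : ℝ) + 1) • _
    rw [nd_add_single α j hfg, pd_smul j hf hg,
      nd_add α (hf.smul (contDiff_pd j hg)) ((contDiff_pd j hf).smul hg),
      ih hf (contDiff_pd j hg), ih (contDiff_pd j hf) hg, Finset.smul_sum]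
    have hsplit : ∀ β : Fin d → ℕ, ((α j : ℝ) + 1) •
        (nd β f x • nd (α + Pi.single j 1 - β) g x) =
        ((α j : ℝ) + 1 - β j) • (nd β f x • nd (α + Pi.single j 1 - β) g x) +
        (β j : ℝ) • (nd β f x • nd (α + Pi.single j 1 - β) g x) := fun β => by
      rw [← add_smul]; congr 1; ring
    rw [Finset.sum_congr rfl fun β _ => hsplit β, Finset.sum_add_distrib]
    refine Eq.symm ((congrArg₂ (· + ·)
      (sum_Iic_add_single_sub_coord_smul α j
        fun β => nd β f x • nd (α + Pi.single j 1 - β) g x)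
      (sum_Iic_add_single_coord_smul α j
        fun β => nd β f x • nd (α + Pi.single j 1 - β) g x)).trans ?_)
    refine congrArg₂ (· + ·) ?_ ?_
    · refine Finset.sum_congr rfl fun β hβ => ?_
      rw [Finset.mem_Iic] at hβ
      rw [← nd_add_single (α - β) j hg, smul_comm, tsub_add_eq_add_tsub hβ]
    · refine Finset.sum_congr rfl fun β hβ => ?_
      rw [← nd_add_single β j hf, add_tsub_add_eq_tsub_right, smul_assoc]

end SmoothCalculus
section PointwiseBounds

variable {d : ℕ}

/-- A nonnegative function with bounded second derivatives controls its own gradient. -/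
lemma sq_pd_le (j : Fin d) {W : Ed d → ℝ} (hW : ContDiff ℝ (⊤ : ℕ∞) W) (hpos : ∀ x, 0 ≤ W x)
    {M : ℝ} (hM : 0 < M) (hbd : ∀ x, |pd d j (pd d j W) x| ≤ M) (x : Ed d) :
    pd d j W x ^ 2 ≤ 4 * M * W x := by
  set e : Ed d := EuclideanSpace.single j 1
  have hline (s : ℝ) : HasDerivAt (fun s : ℝ => x + s • e) e s := by
    simpa using ((hasDerivAt_id s).smul_const e).const_add x
  have hderiv {f : Ed d → ℝ} (hf : ContDiff ℝ (⊤ : ℕ∞) f) (s : ℝ) :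
      HasDerivAt (fun s : ℝ => f (x + s • e)) (pd d j f (x + s • e)) s :=
    (hf.differentiable (by simp) _).hasFDerivAt.comp_hasDerivAt s (hline s)
  set p := pd d j W x
  have hp (s : ℝ) : |pd d j W (x + s • e) - p| ≤ M * |s| := by
    have := convex_univ.norm_image_sub_le_of_norm_hasDerivWithin_le (𝕜 := ℝ)
      (f := fun s : ℝ => pd d j W (x + s • e)) (C := M) (x := 0) (y := s)
      (fun r _ => (hderiv (contDiff_pd j hW) r).hasDerivWithinAt) (fun r _ => hbd _)
      (Set.mem_univ _) (Set.mem_univ _)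
    simpa [p] using this
  have hT (s : ℝ) : |W (x + s • e) - p * s - W x| ≤ M * |s| * |s| := by
    have := (convex_Icc (-|s|) |s|).norm_image_sub_le_of_norm_hasDerivWithin_le (𝕜 := ℝ)
      (f := fun s : ℝ => W (x + s • e) - p * s) (C := M * |s|) (x := 0) (y := s)
      (f' := fun r => pd d j W (x + r • e) - p)
      (fun r _ => by
        have := (hderiv hW r).sub ((hasDerivAt_id r).const_mul p)
        rw [mul_one] at this
        exact this.hasDerivWithinAt)
      (fun r hr => (hp r).trans (mul_le_mul_of_nonneg_left (abs_le.2 hr) hM.le))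
      (Set.mem_Icc.2 (by simp)) (Set.mem_Icc.2 ⟨neg_abs_le s, le_abs_self s⟩)
    simpa using this
  have h1 := (abs_le.1 (hT (-p / (2 * M)))).2
  have h2 := hpos (x + (-p / (2 * M)) • e)
  rw [mul_assoc, abs_mul_abs_self] at h1
  have h3 : M * (-p / (2 * M) * (-p / (2 * M))) + p * (-p / (2 * M)) = - (p ^ 2 / (4 * M)) := by
    field_simp; ring
  have h4 : p ^ 2 / (4 * M) ≤ W x := by linarith
  rw [div_le_iff₀ (by positivity)] at h4
  linarith

lemma sum_Iic_half_pow_mlen_le (α : Fin d → ℕ) :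
    ∑ β ∈ Finset.Iic α, (1 / 2 : ℝ) ^ mlen β ≤ 2 ^ d := by
  have hIic : Finset.Iic α = Fintype.piFinset fun j => Finset.range (α j + 1) := by
    ext β
    simp [Pi.le_def]
  have hgeom (n : ℕ) : ∑ k ∈ Finset.range n, (1 / 2 : ℝ) ^ k ≤ 2 := by
    have := Summable.sum_le_tsum (Finset.range n) (fun k _ => by positivity)
      summable_geometric_two
    rwa [tsum_geometric_two] at this
  calc ∑ β ∈ Finset.Iic α, (1 / 2 : ℝ) ^ mlen β
      = ∏ j, ∑ k ∈ Finset.range (α j + 1), (1 / 2 : ℝ) ^ k := by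
        rw [Finset.prod_univ_sum, hIic]
        exact Finset.sum_congr rfl fun β _ => (Finset.prod_pow_eq_pow_sum _ _ _).symm
    _ ≤ ∏ _j : Fin d, (2 : ℝ) :=
        Finset.prod_le_prod (fun _ _ => Finset.sum_nonneg fun _ _ => by positivity)
          fun _ _ => hgeom _
    _ = 2 ^ d := by simp

lemma mlen_eq_zero_iff {β : Fin d → ℕ} : mlen β = 0 ↔ β = 0 := by
  simp [mlen, funext_iff]

lemma mlen_eq_one {β : Fin d → ℕ} (h : mlen β = 1) : ∃ j, β = Pi.single j 1 := by
  induction β using multiIndex_induction with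
  | zero => simp [mlen] at h
  | step α j _ =>
    rw [mlen_add_single] at h
    have : α = 0 := mlen_eq_zero_iff.1 (by omega)
    exact ⟨j, by simp [this]⟩

lemma mlen_sub_add {α β : Fin d → ℕ} (h : β ≤ α) : mlen (α - β) + mlen β = mlen α := by
  simp only [mlen, ← Finset.sum_add_distrib]
  exact Finset.sum_congr rfl fun j _ => Nat.sub_add_cancel (h j)

/-- Bound for the terms of order at least one in the Leibniz expansion of the potential. -/
lemma coeff_mul_le {n : ℕ} (hn : n ≠ 0) {r s C B M W p q D : ℝ} (hC : 0 < C) (hB : 1 ≤ B)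
    (hCB : 2 * C ≤ B) (hM : 0 < M) (hD : 0 < D) (hW : 0 ≤ W) (hp : 0 ≤ p) (hq : 0 ≤ q)
    (hr1 : n = 1 → r ^ 2 ≤ 4 * M * W) (hr2 : 2 ≤ n → |r| ≤ C ^ (n + 1))
    (hs : |s| ≤ C ^ (n + 1)) :
    (|r| + |s|) * (q * p) ≤ (1 / 2) ^ n *
      (W * p ^ 2 / D + (4 * D * M + C) * (p ^ 2 + B ^ (2 * n) * q ^ 2)) := by
  have hhigh {c : ℝ} (hc : |c| ≤ C ^ (n + 1)) : |c| * (q * p) ≤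
      (1 / 2) ^ n * (C / 2 * (p ^ 2 + B ^ (2 * n) * q ^ 2)) := by
    have h1 : C ^ n ≤ (1 / 2) ^ n * B ^ n := by
      rw [← mul_pow]; exact pow_le_pow_left₀ hC.le (by linarith) n
    have h2 : B ^ (2 * n) = (B ^ n) ^ 2 := by rw [← pow_mul, mul_comm]
    calc |c| * (q * p) ≤ C ^ (n + 1) * (q * p) := by gcongr
      _ = C ^ n * (C * (q * p)) := by ring
      _ ≤ (1 / 2) ^ n * B ^ n * (C * (q * p)) := by gcongr
      _ = (1 / 2) ^ n * (C / 2 * (2 * p * (B ^ n * q))) := by ring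
      _ ≤ _ := by
        rw [h2]
        gcongr
        nlinarith [sq_nonneg (p - B ^ n * q)]
  have hsb := hhigh hs
  have hWp : 0 ≤ W * p ^ 2 / D := by positivity
  set X := p ^ 2 + B ^ (2 * n) * q ^ 2 with hX
  have hX0 : 0 ≤ X := by positivity
  by_cases h2 : 2 ≤ n
  · have hrb := hhigh (hr2 h2)
    calc (|r| + |s|) * (q * p) ≤ (1 / 2) ^ n * (C * X) := by linarith
      _ ≤ _ := by
        gcongr
        have : 0 ≤ 4 * D * M * X := by positivity
        linarith
  · have h1 : n = 1 := by omega
    subst h1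
    have hqX : q ^ 2 ≤ X := by
      have : 1 * q ^ 2 ≤ B ^ (2 * 1) * q ^ 2 := by gcongr; exact one_le_pow₀ hB
      have := sq_nonneg p
      linarith
    have hrb : |r| * (q * p) ≤ W * p ^ 2 / (2 * D) + 2 * D * M * q ^ 2 := by
      refine le_of_sq_le_sq ?_ (by positivity)
      have h3 : (|r| * (q * p)) ^ 2 ≤ 4 * M * W * (q * p) ^ 2 := by
        rw [mul_pow, sq_abs]
        exact mul_le_mul_of_nonneg_right (hr1 rfl) (sq_nonneg _)
      have h4 : 4 * M * W * (q * p) ^ 2 = 4 * (W * p ^ 2 / (2 * D)) * (2 * D * M * q ^ 2) := by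
        field_simp
      nlinarith [sq_nonneg (W * p ^ 2 / (2 * D) - 2 * D * M * q ^ 2)]
    have h5 : W * p ^ 2 / (2 * D) = 1 / 2 * (W * p ^ 2 / D) := by field_simp
    have h6 : 2 * D * M * q ^ 2 ≤ 2 * D * M * X := by gcongr
    have h7 : 0 ≤ C * X := by positivity
    simp only [pow_one] at hsb ⊢
    linarith

/-- The order zero term of the potential absorbs the first order ones. -/
lemma neg_inner_leibniz_le (α : Fin d → ℕ) {r s : (Fin d → ℕ) → ℝ} {q q' : (Fin d → ℕ) → ℂ}
    {C₀ C B M : ℝ} (hC : 0 < C) (hB : 1 ≤ B) (hCB : 2 * C ≤ B) (hM : 0 < M)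
    (hr0 : -C₀ ≤ r 0) (hr1 : ∀ β, mlen β = 1 → r β ^ 2 ≤ 4 * M * (r 0 + C₀))
    (hr2 : ∀ β, 2 ≤ mlen β → |r β| ≤ C ^ (mlen β + 1))
    (hs : ∀ β, 1 ≤ mlen β → |s β| ≤ C ^ (mlen β + 1))
    (hq' : ∀ β, ‖q' β‖ = ‖q β‖) (hq0 : inner ℝ (q 0) (q' 0) = 0) :
    -inner ℝ (q 0) (∑ β ∈ Finset.Iic α, (r β • q β + s β • q' β)) ≤ C₀ * ‖q 0‖ ^ 2 +
      ∑ β ∈ Finset.Iic α, (4 * 2 ^ d * M + C) *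
        ((1 / 2) ^ mlen β * (‖q 0‖ ^ 2 + B ^ (2 * mlen β) * ‖q β‖ ^ 2)) := by
  have hW : 0 ≤ r 0 + C₀ := by linarith
  set p := ‖q 0‖
  set K : ℝ := 4 * 2 ^ d * M + C with hK
  have hK0 : 0 < K := by positivity
  have h0 : (0 : Fin d → ℕ) ∈ Finset.Iic α := by simp
  have hterm (β : Fin d → ℕ) (hβ : β ≠ 0) : -inner ℝ (q 0) (r β • q β + s β • q' β) ≤
      (1 / 2) ^ mlen β * ((r 0 + C₀) * p ^ 2 / 2 ^ d) +
      K * ((1 / 2) ^ mlen β * (p ^ 2 + B ^ (2 * mlen β) * ‖q β‖ ^ 2)) := by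
    have hn : mlen β ≠ 0 := fun h => hβ (mlen_eq_zero_iff.1 h)
    have hmain := coeff_mul_le hn (q := ‖q β‖) (p := p) (D := 2 ^ d) hC hB hCB hM
      (by positivity) hW (norm_nonneg _) (norm_nonneg _) (hr1 β) (hr2 β) (hs β (by omega))
    have hCS : -inner ℝ (q 0) (r β • q β + s β • q' β) ≤ (|r β| + |s β|) * (‖q β‖ * p) := by
      refine (neg_le_abs _).trans ((abs_real_inner_le_norm _ _).trans ?_)
      have := norm_add_le (r β • q β) (s β • q' β)
      rw [norm_smul, norm_smul, hq', Real.norm_eq_abs, Real.norm_eq_abs] at this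
      calc ‖q 0‖ * _ ≤ ‖q 0‖ * (|r β| * ‖q β‖ + |s β| * ‖q β‖) := by gcongr
        _ = _ := by ring
    refine hCS.trans (hmain.trans (le_of_eq ?_))
    rw [hK]; ring
  have hzero : -inner ℝ (q 0) (r 0 • q 0 + s 0 • q' 0) = -(r 0 * p ^ 2) := by
    rw [inner_add_right, inner_smul_right, inner_smul_right, hq0, real_inner_self_eq_norm_sq]
    simp [p]
  have hhalf : ∑ β ∈ (Finset.Iic α).erase 0, (1 / 2 : ℝ) ^ mlen β ≤ 2 ^ d :=
    (Finset.sum_le_sum_of_subset_of_nonneg (Finset.erase_subset _ _)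
      fun _ _ _ => by positivity).trans (sum_Iic_half_pow_mlen_le α)
  rw [inner_sum, ← Finset.sum_neg_distrib, ← Finset.add_sum_erase _ _ h0, hzero,
    ← Finset.add_sum_erase (Finset.Iic α) (fun β => K * _) h0]
  have hsum := Finset.sum_le_sum fun β hβ => hterm β (Finset.ne_of_mem_erase (s := Finset.Iic α) hβ)
  rw [Finset.sum_add_distrib, ← Finset.sum_mul] at hsum
  have habs : (∑ β ∈ (Finset.Iic α).erase 0, (1 / 2 : ℝ) ^ mlen β) *
      ((r 0 + C₀) * p ^ 2 / 2 ^ d) ≤ (r 0 + C₀) * p ^ 2 := by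
    calc _ ≤ 2 ^ d * ((r 0 + C₀) * p ^ 2 / 2 ^ d) := by gcongr
      _ = _ := by field_simp
  have hextra : 0 ≤ K * ((1 / 2) ^ mlen (0 : Fin d → ℕ) *
      (p ^ 2 + B ^ (2 * mlen (0 : Fin d → ℕ)) * ‖q 0‖ ^ 2)) := by positivity
  linarith

end PointwiseBounds
section Schwartz

open scoped SchwartzMap LineDeriv

variable {d : ℕ}

/-- The partial derivative as an operator on Schwartz functions. -/
def pdS (j : Fin d) : 𝓢(Ed d, ℂ) →L[ℝ] 𝓢(Ed d, ℂ) :=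
  LineDeriv.lineDerivOpCLM ℝ 𝓢(Ed d, ℂ) (EuclideanSpace.single j (1 : ℝ))

lemma coe_pdS (j : Fin d) (f : 𝓢(Ed d, ℂ)) : ⇑(pdS j f) = pd d j ⇑f := by
  funext x
  simp [pdS, pd, SchwartzMap.lineDerivOp_apply_eq_fderiv]

/-- The normalised derivative `∂^α / α!` as an operator on Schwartz functions. -/
def ndS (α : Fin d → ℕ) : 𝓢(Ed d, ℂ) →L[ℝ] 𝓢(Ed d, ℂ) :=
  (mfact α : ℝ)⁻¹ • (List.finRange d).foldr (fun j g => (pdS j ^ α j) ∘L g) (.id ℝ _)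

lemma coe_ndS (α : Fin d → ℕ) (f : 𝓢(Ed d, ℂ)) : ⇑(ndS α f) = nd α ⇑f := by
  have hpow (j : Fin d) (n : ℕ) (f : 𝓢(Ed d, ℂ)) : ⇑((pdS j ^ n) f) = (pd d j)^[n] ⇑f := by
    induction n with
    | zero => rfl
    | succ n ih =>
      rw [pow_succ', Function.iterate_succ_apply', ← ih]
      exact coe_pdS j _
  have hfold (l : List (Fin d)) : ⇑(l.foldr (fun j g => (pdS j ^ α j) ∘L g) (.id ℝ _) f) =
      l.foldr (fun j g => (pd d j)^[α j] g) ⇑f := by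
    induction l with
    | nil => rfl
    | cons i l ih =>
      simp only [List.foldr_cons, ← ih]
      exact hpow i _ _
  funext x
  simp only [ndS, nd, md, ← hfold]
  rfl

lemma smooth_coe (f : 𝓢(Ed d, ℂ)) : ContDiff ℝ (⊤ : ℕ∞) ⇑f := f.smooth _

lemma ndS_pdS (α : Fin d → ℕ) (j : Fin d) (f : 𝓢(Ed d, ℂ)) :
    ndS α (pdS j f) = pdS j (ndS α f) := by
  ext x
  have hmd : Differentiable ℝ (md α ⇑f) :=
    (contDiff_md α (smooth_coe f)).differentiable (by simp)
  rw [coe_ndS, coe_pdS, coe_pdS, coe_ndS]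
  simp only [nd, md_pd α j (smooth_coe f), pd]
  change _ = fderiv ℝ (fun y => (mfact α : ℝ)⁻¹ • md α ⇑f y) x _
  rw [fderiv_fun_const_smul (hmd x)]
  rfl

lemma integrable_inner (f g : 𝓢(Ed d, ℂ)) : Integrable fun x => inner ℝ (f x) (g x) :=
  (SchwartzMap.pairing (innerSL ℝ) f g).integrable

lemma integrable_norm_sq (f : 𝓢(Ed d, ℂ)) : Integrable fun x => ‖f x‖ ^ 2 := by
  simpa only [real_inner_self_eq_norm_sq] using integrable_inner f f

lemma integral_inner_pdS (f g : 𝓢(Ed d, ℂ)) (j : Fin d) :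
    ∫ x, inner ℝ (f x) (pdS j g x) = -∫ x, inner ℝ (pdS j f x) (g x) :=
  SchwartzMap.integral_bilinear_lineDerivOp_right_eq_neg_left f g (innerSL ℝ) _

lemma integral_inner_pdS_self (f : 𝓢(Ed d, ℂ)) (j : Fin d) :
    ∫ x, inner ℝ (f x) (pdS j f x) = 0 := by
  have h := integral_inner_pdS f f j
  simp only [real_inner_comm (f _) (pdS j f _)] at h
  linarith

lemma integral_inner_pdS_pdS_self_nonpos (f : 𝓢(Ed d, ℂ)) (j : Fin d) :
    ∫ x, inner ℝ (f x) (pdS j (pdS j f) x) ≤ 0 := by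
  rw [integral_inner_pdS, neg_nonpos]
  exact integral_nonneg fun x => real_inner_self_nonneg

lemma norm_toLp_sq (f : 𝓢(Ed d, ℂ)) : ‖f.toLp 2‖ ^ 2 = ∫ x, ‖f x‖ ^ 2 := by
  rw [← real_inner_self_eq_norm_sq, L2.inner_def]
  refine integral_congr_ae ?_
  filter_upwards [f.coeFn_toLp 2] with x hx
  rw [hx, real_inner_self_eq_norm_sq]

lemma inner_toLp (f g : 𝓢(Ed d, ℂ)) :
    inner ℝ (f.toLp 2) (g.toLp 2) = ∫ x, inner ℝ (f x) (g x) := by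
  rw [L2.inner_def]
  refine integral_congr_ae ?_
  filter_upwards [f.coeFn_toLp 2, g.coeFn_toLp 2] with x hx hy
  rw [hx, hy]

lemma hasDerivWithinAt_integral_norm_sq {s : Set ℝ} {t : ℝ} {u : ℝ → 𝓢(Ed d, ℂ)}
    {v : 𝓢(Ed d, ℂ)} (L : 𝓢(Ed d, ℂ) →L[ℝ] 𝓢(Ed d, ℂ))
    (hu : Tendsto (fun r => (r - t)⁻¹ • (u r - u t)) (nhdsWithin t (s \ {t})) (nhds v)) :
    HasDerivWithinAt (fun r => ∫ x, ‖L (u r) x‖ ^ 2) (2 * ∫ x, inner ℝ (L (u t) x) (L v x))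
      s t := by
  let Φ : 𝓢(Ed d, ℂ) →L[ℝ] Lp ℂ 2 (volume : Measure (Ed d)) :=
    (SchwartzMap.toLpCLM ℝ ℂ 2 volume) ∘L L
  have hΦ : HasDerivWithinAt (fun r => Φ (u r)) (Φ v) s t := by
    rw [hasDerivWithinAt_iff_tendsto_slope]
    refine ((Φ.continuous.tendsto v).comp hu).congr fun r => ?_
    simp [slope_def_module]
  have h : HasDerivWithinAt (fun r => ‖(L (u r)).toLp 2‖ ^ 2)
      (2 * inner ℝ ((L (u t)).toLp 2) ((L v).toLp 2)) s t := hΦ.norm_sq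
  simpa only [norm_toLp_sq, inner_toLp] using h

end Schwartz
section Energy

open scoped SchwartzMap

variable {d : ℕ}

lemma abs_nd_le (β : Fin d → ℕ) {V : Ed d → ℝ} {x : Ed d} {b : ℝ}
    (h : |md β V x| ≤ b * (mfact β : ℝ)) : |nd β V x| ≤ b := by
  have hpos : (0 : ℝ) < mfact β := by exact_mod_cast mfact_pos β
  rw [nd, smul_eq_mul, abs_mul, abs_inv, abs_of_pos hpos, inv_mul_le_iff₀ hpos, mul_comm]
  exact h

lemma sq_nd_le_of_mlen_eq_one {V : Ed d → ℝ} (hV : ContDiff ℝ (⊤ : ℕ∞) V) {C₀ C : ℝ}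
    (hC : 0 < C) (hlower : ∀ x, -C₀ ≤ V x)
    (hbd : ∀ β : Fin d → ℕ, 2 ≤ mlen β → ∀ x, |md β V x| ≤ C ^ (mlen β + 1) * (mfact β : ℝ))
    {β : Fin d → ℕ} (hβ : mlen β = 1) (x : Ed d) :
    nd β V x ^ 2 ≤ 4 * (2 * C ^ 3) * (nd 0 V x + C₀) := by
  obtain ⟨j, rfl⟩ := mlen_eq_one hβ
  have h1 : nd (Pi.single j 1) V x = pd d j V x := by
    have := nd_add_single 0 j hV x
    simpa [nd_zero] using this
  have hpd : pd d j (fun y => V y + C₀) = pd d j V := by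
    funext y
    simp [pd]
  have hWsmooth : ContDiff ℝ (⊤ : ℕ∞) fun y => V y + C₀ := hV.add contDiff_const
  have h2 : md (Pi.single j 1 + Pi.single j 1) V = pd d j (pd d j V) := by
    rw [md_add_single _ j hV]
    have := md_add_single 0 j (contDiff_pd j hV)
    rwa [md_zero, zero_add] at this
  have hlen : mlen (Pi.single j 1 + Pi.single j 1 : Fin d → ℕ) = 2 := by
    rw [mlen_add_single, hβ]
  have hfact : mfact (Pi.single j 1 + Pi.single j 1 : Fin d → ℕ) = 2 := by
    have := mfact_add_single 0 j
    rw [zero_add] at this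
    rw [mfact_add_single, this]
    simp [mfact]
  rw [h1, nd_zero, ← hpd]
  refine sq_pd_le j hWsmooth (fun y => by linarith [hlower y]) (by positivity) (fun y => ?_) x
  have := hbd _ hlen.ge y
  rw [h2, hlen, hfact] at this
  rw [hpd]
  norm_num at this
  linarith

/-- The energy inequality for the normalised derivatives at a fixed time. -/
lemma integral_inner_ndS_le {a aa : Fin d → ℝ → ℝ} {V₁ V₂ : ℝ → Ed d → ℝ} {t C₀ C B : ℝ}
    (ha : ∀ j, 0 ≤ a j t) (hC : 0 < C) (hB : 1 ≤ B) (hCB : 2 * C ≤ B)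
    (hV₁ : ContDiff ℝ (⊤ : ℕ∞) (V₁ t)) (hV₂ : ContDiff ℝ (⊤ : ℕ∞) (V₂ t))
    (hlower : ∀ x, -C₀ ≤ V₁ t x)
    (hV₁bd : ∀ β : Fin d → ℕ, 2 ≤ mlen β → ∀ x,
      |md β (V₁ t) x| ≤ C ^ (mlen β + 1) * (mfact β : ℝ))
    (hV₂bd : ∀ β : Fin d → ℕ, 1 ≤ mlen β → ∀ x,
      |md β (V₂ t) x| ≤ C ^ (mlen β + 1) * (mfact β : ℝ))
    {f f' : 𝓢(Ed d, ℂ)} (heq : ∀ x, f' x + LopT a aa V₁ V₂ t (⇑f) x = 0) (α : Fin d → ℕ) :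
    ∫ x, inner ℝ (ndS α f x) (ndS α f' x) ≤ C₀ * (∫ x, ‖ndS α f x‖ ^ 2) +
      ∑ β ∈ Finset.Iic α, (4 * 2 ^ d * (2 * C ^ 3) + C) * ((1 / 2) ^ mlen β *
        ((∫ x, ‖ndS α f x‖ ^ 2) + B ^ (2 * mlen β) * ∫ x, ‖ndS (α - β) f x‖ ^ 2)) := by
  set w := ndS α f
  let Λ : 𝓢(Ed d, ℂ) →L[ℝ] ℝ :=
    (innerSL ℝ (w.toLp 2 (volume : Measure (Ed d)))) ∘L SchwartzMap.toLpCLM ℝ ℂ 2 volume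
  have hΛ (g : 𝓢(Ed d, ℂ)) : Λ g = ∫ x, inner ℝ (w x) (g x) := inner_toLp w g
  set Z : 𝓢(Ed d, ℂ) := ∑ j, a j t • pdS j (pdS j f) - ∑ j, aa j t • pdS j f with hZ
  set Q : 𝓢(Ed d, ℂ) := Z - f' with hQ
  have hΛZ : Λ (ndS α Z) ≤ 0 := by
    have h0 : ∀ j, Λ (pdS j w) = 0 := fun j => (hΛ _).trans (integral_inner_pdS_self w j)
    simp only [hZ, map_sub, map_sum, map_smul, ndS_pdS]
    simp only [w] at h0
    simp only [h0, smul_zero, Finset.sum_const_zero, sub_zero]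
    refine Finset.sum_nonpos fun j _ => ?_
    rw [smul_eq_mul, hΛ]
    exact mul_nonpos_of_nonneg_of_nonpos (ha j) (integral_inner_pdS_pdS_self_nonpos w j)
  let L : ℂ →L[ℝ] ℂ := ContinuousLinearMap.mul ℝ ℂ Complex.I
  have hQfun : ⇑Q = V₁ t • ⇑f + V₂ t • (L ∘ ⇑f) := by
    funext x
    have h := heq x
    have hZx : Z x = ∑ j, (a j t : ℂ) * pd d j (pd d j ⇑f) x -
        ∑ j, (aa j t : ℂ) * pd d j ⇑f x := by
      simp [hZ, coe_pdS]
    have hQx : Q x = Z x - f' x := rfl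
    rw [hQx, hZx, eq_neg_of_add_eq_zero_left h]
    simp only [LopT, L, Pi.add_apply, Pi.smul_apply', Function.comp_apply,
      ContinuousLinearMap.mul_apply', Complex.real_smul]
    ring
  have hLf : ContDiff ℝ (⊤ : ℕ∞) (L ∘ ⇑f) := L.contDiff.comp (smooth_coe f)
  have hndL (γ : Fin d → ℕ) (x : Ed d) : nd γ (L ∘ ⇑f) x = L (nd γ ⇑f x) := by
    simp only [nd, md_clm_comp L γ (smooth_coe f), Function.comp_apply, map_smul]
  have hQexp (x : Ed d) : ndS α Q x = ∑ β ∈ Finset.Iic α,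
      (nd β (V₁ t) x • ndS (α - β) f x + nd β (V₂ t) x • L (ndS (α - β) f x)) := by
    simp only [coe_ndS]
    rw [hQfun, nd_add α (hV₁.smul (smooth_coe f)) (hV₂.smul hLf), nd_smul α hV₁ (smooth_coe f),
      nd_smul α hV₂ hLf, ← Finset.sum_add_distrib]
    simp only [hndL]
  have hpt (x : Ed d) : -inner ℝ (w x) (ndS α Q x) ≤ C₀ * ‖w x‖ ^ 2 +
      ∑ β ∈ Finset.Iic α, (4 * 2 ^ d * (2 * C ^ 3) + C) * ((1 / 2) ^ mlen β *
        (‖w x‖ ^ 2 + B ^ (2 * mlen β) * ‖ndS (α - β) f x‖ ^ 2)) := by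
    have := neg_inner_leibniz_le α (r := fun β => nd β (V₁ t) x) (s := fun β => nd β (V₂ t) x)
      (q := fun β => ndS (α - β) f x) (q' := fun β => L (ndS (α - β) f x))
      (C₀ := C₀) (M := 2 * C ^ 3) hC hB hCB (by positivity) (by simpa [nd_zero] using hlower x)
      (fun β hβ => sq_nd_le_of_mlen_eq_one hV₁ hC hlower hV₁bd hβ x)
      (fun β hβ => abs_nd_le β (hV₁bd β hβ x)) (fun β hβ => abs_nd_le β (hV₂bd β hβ x))
      (fun β => by simp [L]) (by simp [L, Complex.inner]; ring)
    simpa only [hQexp, tsub_zero] using this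
  have hint (γ : Fin d → ℕ) := integrable_norm_sq (ndS γ f)
  have hterm (β : Fin d → ℕ) : Integrable fun x => (4 * 2 ^ d * (2 * C ^ 3) + C) *
      ((1 / 2) ^ mlen β * (‖w x‖ ^ 2 + B ^ (2 * mlen β) * ‖ndS (α - β) f x‖ ^ 2)) :=
    (((hint α).add ((hint (α - β)).const_mul _)).const_mul _).const_mul _
  have hmono := integral_mono (integrable_inner w (ndS α Q)).neg
    (((hint α).const_mul C₀).add (integrable_finsetSum (Finset.Iic α) fun β _ => hterm β)) hpt
  have hsplit : Λ (ndS α f') = Λ (ndS α Z) - Λ (ndS α Q) := by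
    rw [← map_sub, ← map_sub, hQ, sub_sub_cancel]
  have hQΛ : ∫ x, -inner ℝ (w x) (ndS α Q x) = -Λ (ndS α Q) := by rw [integral_neg, hΛ]
  have hrhs : (∫ x, (C₀ * ‖w x‖ ^ 2 + ∑ β ∈ Finset.Iic α, (4 * 2 ^ d * (2 * C ^ 3) + C) *
      ((1 / 2) ^ mlen β * (‖w x‖ ^ 2 + B ^ (2 * mlen β) * ‖ndS (α - β) f x‖ ^ 2)))) =
      C₀ * (∫ x, ‖w x‖ ^ 2) + ∑ β ∈ Finset.Iic α, (4 * 2 ^ d * (2 * C ^ 3) + C) *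
        ((1 / 2) ^ mlen β * ((∫ x, ‖w x‖ ^ 2) +
          B ^ (2 * mlen β) * ∫ x, ‖ndS (α - β) f x‖ ^ 2)) := by
    rw [integral_add ((hint α).const_mul C₀)
      (integrable_finsetSum (Finset.Iic α) fun β _ => hterm β), integral_const_mul,
      integral_finsetSum _ fun β _ => hterm β]
    congr 1
    refine Finset.sum_congr rfl fun β _ => ?_
    rw [integral_const_mul, integral_const_mul,
      integral_add (hint α) ((hint (α - β)).const_mul _), integral_const_mul]
  rw [← hΛ, hsplit, ← hrhs]
  refine le_trans ?_ hmono
  change _ ≤ ∫ x, -inner ℝ (w x) (ndS α Q x)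
  rw [hQΛ]
  linarith

/-- A linear differential inequality with exponential forcing. -/
lemma le_mul_exp_of_hasDerivWithinAt {T c c' G : ℝ} {N N' : ℝ → ℝ}
    (hN : ∀ t ∈ Set.Icc 0 T, HasDerivWithinAt N (N' t) (Set.Icc 0 T) t)
    (hle : ∀ t ∈ Set.Icc 0 T, N' t ≤ c * N t + c' * (G * Real.exp ((c + c') * t)))
    (h0 : N 0 ≤ G) {t : ℝ} (ht : t ∈ Set.Icc 0 T) : N t ≤ G * Real.exp ((c + c') * t) := by
  have hexp (k s : ℝ) : HasDerivAt (fun s => Real.exp (k * s)) (Real.exp (k * s) * k) s := by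
    simpa using ((hasDerivAt_id s).const_mul k).exp
  set h : ℝ → ℝ := fun s => (N s - G * Real.exp ((c + c') * s)) * Real.exp (-c * s)
  have hderiv (s : ℝ) (hs : s ∈ Set.Icc 0 T) : HasDerivWithinAt h
      ((N' s - G * (Real.exp ((c + c') * s) * (c + c'))) * Real.exp (-c * s) +
        (N s - G * Real.exp ((c + c') * s)) * (Real.exp (-c * s) * -c)) (Set.Icc 0 T) s :=
    ((hN s hs).sub ((hexp (c + c') s).const_mul G).hasDerivWithinAt).mul
      (hexp (-c) s).hasDerivWithinAt
  have hanti : AntitoneOn h (Set.Icc 0 T) := by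
    refine antitoneOn_of_deriv_nonpos (convex_Icc 0 T)
      (fun s hs => (hderiv s hs).continuousWithinAt)
      (fun s hs => ((hderiv s (interior_subset hs)).mono interior_subset).differentiableWithinAt)
      fun s hs => ?_
    have hs' := interior_subset hs
    rw [((hderiv s hs').hasDerivAt (mem_interior_iff_mem_nhds.1 hs)).deriv]
    have := hle s hs'
    have hfac : (N' s - G * (Real.exp ((c + c') * s) * (c + c'))) * Real.exp (-c * s) +
        (N s - G * Real.exp ((c + c') * s)) * (Real.exp (-c * s) * -c) =
        (N' s - (c * N s + c' * (G * Real.exp ((c + c') * s)))) * Real.exp (-c * s) := by ring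
    rw [hfac]
    exact mul_nonpos_of_nonpos_of_nonneg (by linarith) (Real.exp_pos _).le
  have hle0 : h t ≤ 0 := by
    refine (hanti ⟨le_rfl, ht.1.trans ht.2⟩ ht ht.1).trans ?_
    simpa [h] using h0
  have := nonpos_of_mul_nonpos_left hle0 (Real.exp_pos _)
  linarith

lemma l2norm_md_eq (α : Fin d → ℕ) (f : 𝓢(Ed d, ℂ)) :
    l2norm (md α ⇑f) = mfact α * Real.sqrt (∫ x, ‖ndS α f x‖ ^ 2) := by
  have hpos : (0 : ℝ) < mfact α := by exact_mod_cast mfact_pos α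
  have h (x : Ed d) : ‖md α ⇑f x‖ ^ 2 = (mfact α : ℝ) ^ 2 * ‖ndS α f x‖ ^ 2 := by
    rw [coe_ndS, nd, norm_smul, ← mul_pow, norm_inv, Real.norm_of_nonneg hpos.le,
      mul_inv_cancel_left₀ hpos.ne']
  simp only [l2norm, h, integral_const_mul]
  rw [Real.sqrt_mul (sq_nonneg _), Real.sqrt_sq hpos.le]

end Energy

/-- The flow of the parabolic operator with coefficients analytic in `x` preserves the
class `𝒜` of analytic-type functions (Theorem 6.1, for the model operator). -/
theorem statement18 (d : ℕ) (hd : 1 ≤ d) (T : ℝ) (hT : 0 < T)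
    (C₀ C : ℝ) (hC₀ : 0 < C₀) (hC : 0 < C)
    (a aa : Fin d → ℝ → ℝ)
    (haCont : ∀ j, ContinuousOn (a j) (Set.Icc 0 T))
    (haaCont : ∀ j, ContinuousOn (aa j) (Set.Icc 0 T))
    (haPos : ∀ j, ∀ t ∈ Set.Icc (0:ℝ) T, 0 ≤ a j t)
    (V₁ V₂ : ℝ → Ed d → ℝ)
    (hV₁smooth : ∀ t ∈ Set.Icc (0:ℝ) T, ContDiff ℝ (⊤ : ℕ∞) (V₁ t))
    (hV₂smooth : ∀ t ∈ Set.Icc (0:ℝ) T, ContDiff ℝ (⊤ : ℕ∞) (V₂ t))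
    (hV₁cont : ∀ β : Fin d → ℕ, ContinuousOn (fun p : ℝ × Ed d => md β (V₁ p.1) p.2)
      (Set.Icc 0 T ×ˢ Set.univ))
    (hV₂cont : ∀ β : Fin d → ℕ, ContinuousOn (fun p : ℝ × Ed d => md β (V₂ p.1) p.2)
      (Set.Icc 0 T ×ˢ Set.univ))
    (hV₁lower : ∀ t ∈ Set.Icc (0:ℝ) T, ∀ x, -C₀ ≤ V₁ t x)
    (hV₁bd : ∀ β : Fin d → ℕ, 2 ≤ mlen β → ∀ t ∈ Set.Icc (0:ℝ) T, ∀ x,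
      |md β (V₁ t) x| ≤ C ^ (mlen β + 1) * (mfact β : ℝ))
    (hV₂bd : ∀ β : Fin d → ℕ, 1 ≤ mlen β → ∀ t ∈ Set.Icc (0:ℝ) T, ∀ x,
      |md β (V₂ t) x| ≤ C ^ (mlen β + 1) * (mfact β : ℝ))
    (u u' : ℝ → SchwartzMap (Ed d) ℂ)
    -- u is a C¹ curve in 𝒮(ℝ^d) with derivative u'
    (hucont : ContinuousOn u (Set.Icc 0 T))
    (hu'cont : ContinuousOn u' (Set.Icc 0 T))
    (huderiv : ∀ t ∈ Set.Icc (0:ℝ) T, Filter.Tendsto (fun s => (s - t)⁻¹ • (u s - u t))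
      (nhdsWithin t (Set.Icc 0 T \ {t})) (nhds (u' t)))
    -- the equation u' + ℒ(t)u = 0
    (hueq : ∀ t ∈ Set.Icc (0:ℝ) T, ∀ x, u' t x + LopT a aa V₁ V₂ t (⇑(u t)) x = 0)
    (A : ℝ) (hA : 0 < A)
    (hu0an : ∀ α : Fin d → ℕ, l2norm (md α ⇑(u 0)) ≤ A ^ (mlen α + 1) * (mfact α : ℝ)) :
    ∃ A' > (0 : ℝ), ∀ t ∈ Set.Icc (0:ℝ) T, ∀ α : Fin d → ℕ,
      l2norm (md α ⇑(u t)) ≤ A' ^ (mlen α + 1) * (mfact α : ℝ) := by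
  set B : ℝ := max 1 (max (2 * C) A)
  have hB : 1 ≤ B := le_max_left _ _
  have hCB : 2 * C ≤ B := (le_max_left _ _).trans (le_max_right _ _)
  have hAB : A ≤ B := (le_max_right _ _).trans (le_max_right _ _)
  set K : ℝ := 4 * 2 ^ d * (2 * C ^ 3) + C with hK
  have hK0 : 0 < K := by positivity
  set c : ℝ := 2 * C₀ + 4 * (K * 2 ^ d)
  set c' : ℝ := 2 * (K * 2 ^ d)
  have henergy (n : ℕ) : ∀ α : Fin d → ℕ, mlen α = n → ∀ t ∈ Set.Icc (0 : ℝ) T,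
      ∫ x, ‖ndS α (u t) x‖ ^ 2 ≤ A ^ 2 * B ^ (2 * mlen α) * Real.exp ((c + c') * t) := by
    induction n using Nat.strong_induction_on with
    | _ n ih =>
      rintro α rfl t ht
      refine le_mul_exp_of_hasDerivWithinAt
        (fun s hs => hasDerivWithinAt_integral_norm_sq (ndS α) (huderiv s hs))
        (fun s hs => ?_) ?_ ht
      · set E := ∫ x, ‖ndS α (u s) x‖ ^ 2
        have hE : 0 ≤ E := integral_nonneg fun x => by positivity
        set G := A ^ 2 * B ^ (2 * mlen α) * Real.exp ((c + c') * s) with hG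
        have hG0 : 0 ≤ G := by positivity
        have hineq := integral_inner_ndS_le (fun j => haPos j s hs) hC hB hCB (hV₁smooth s hs)
          (hV₂smooth s hs) (hV₁lower s hs) (fun β hβ => hV₁bd β hβ s hs)
          (fun β hβ => hV₂bd β hβ s hs) (hueq s hs) α
        have hlow (β : Fin d → ℕ) (hβ : β ∈ Finset.Iic α) :
            B ^ (2 * mlen β) * ∫ x, ‖ndS (α - β) (u s) x‖ ^ 2 ≤ E + G := by
          have hlen := mlen_sub_add (Finset.mem_Iic.1 hβ)
          rcases eq_or_ne β 0 with rfl | hβ0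
          · simp only [mlen_eq_zero_iff.2 rfl, tsub_zero, mul_zero, pow_zero, one_mul]
            linarith
          · have hpos : mlen β ≠ 0 := fun h => hβ0 (mlen_eq_zero_iff.1 h)
            calc _ ≤ B ^ (2 * mlen β) *
                (A ^ 2 * B ^ (2 * mlen (α - β)) * Real.exp ((c + c') * s)) := by
                  gcongr
                  exact ih (mlen (α - β)) (by omega) _ rfl s hs
              _ = G := by rw [hG, ← hlen]; ring
              _ ≤ E + G := by linarith
        have hsum : ∑ β ∈ Finset.Iic α, K * ((1 / 2) ^ mlen β *
            (E + B ^ (2 * mlen β) * ∫ x, ‖ndS (α - β) (u s) x‖ ^ 2)) ≤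
            K * (2 ^ d * (2 * E + G)) := by
          rw [← Finset.mul_sum]
          gcongr
          calc _ ≤ ∑ β ∈ Finset.Iic α, (1 / 2) ^ mlen β * (2 * E + G) :=
                Finset.sum_le_sum fun β hβ =>
                  mul_le_mul_of_nonneg_left (by linarith [hlow β hβ]) (by positivity)
            _ ≤ _ := by
                rw [← Finset.sum_mul]
                gcongr
                exact sum_Iic_half_pow_mlen_le α
        calc _ ≤ 2 * (C₀ * E + K * (2 ^ d * (2 * E + G))) := by linarith
          _ = c * E + c' * G := by simp only [c, c']; ring
      · have h := hu0an α
        rw [l2norm_md_eq, mul_comm] at h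
        have hpos : (0 : ℝ) < mfact α := by exact_mod_cast mfact_pos α
        have h' := (Real.sqrt_le_left (by positivity)).1 (le_of_mul_le_mul_right h hpos)
        calc _ ≤ (A ^ (mlen α + 1)) ^ 2 := h'
          _ = A ^ 2 * A ^ (2 * mlen α) := by ring
          _ ≤ _ := by gcongr
  set R := A * Real.exp ((c + c') * T)
  refine ⟨max B R, by positivity, fun t ht α => ?_⟩
  have hc : 0 ≤ c + c' := by positivity
  have hexp : Real.exp ((c + c') * t) ≤ Real.exp ((c + c') * T) ^ 2 := by
    rw [← Real.exp_nat_mul]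
    have h1 := mul_le_mul_of_nonneg_left ht.2 hc
    have h2 := mul_nonneg hc hT.le
    refine Real.exp_le_exp.2 ?_
    push_cast
    linarith
  have hsqrt : Real.sqrt (∫ x, ‖ndS α (u t) x‖ ^ 2) ≤ (max B R) ^ (mlen α + 1) := by
    refine Real.sqrt_le_iff.2 ⟨by positivity, (henergy _ α rfl t ht).trans ?_⟩
    calc _ ≤ A ^ 2 * B ^ (2 * mlen α) * Real.exp ((c + c') * T) ^ 2 := by gcongr
      _ = (B ^ mlen α * R) ^ 2 := by simp only [R]; ring
      _ ≤ (max B R ^ mlen α * max B R) ^ 2 := by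
        gcongr
        · exact le_max_left _ _
        · exact le_max_right _ _
      _ = _ := by ring
  rw [l2norm_md_eq, mul_comm]
  gcongr
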